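/- arXiv:1602.09110 — 6 statements merged into one kernel-verified Lean document; each statement's English description precedes it below -/
import Mathlib

section
/- Let 𝛃 = (β₀, 𝛃⃗) ∈ ℝ⁴ be future-directed timelike, i.e. β₀ > ‖𝛃⃗‖. Then the function p ↦ ‖p‖⁻¹ (e^{β₀‖p‖ − ⟨𝛃⃗,p⟩} − 1)⁻¹ is integrable on ℝ³ and (2π)⁻³ ∫_{ℝ³} ‖p‖⁻¹ (e^{β₀‖p‖ − ⟨𝛃⃗,p⟩} − 1)⁻¹ dp = 1/(12(β₀² − ‖𝛃⃗‖²)). (Lorentz-covariant form of the thermal function of the Wick square: Θ(𝛃) = 1/(12 𝛃²) depends only on the Minkowski square 𝛃² = β₀² − ‖𝛃⃗‖².) -/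
open MeasureTheory Real
open scoped RealInnerProductSpace

lemma lintegral_radial_exp_neg_sqrt {a : ℝ} (ha : 0 < a) (x : ℝ) :
    ∫⁻ ρ in Set.Ioi (0 : ℝ),
      ENNReal.ofReal (ρ * ((√(x ^ 2 + ρ ^ 2))⁻¹ * exp (-(a * √(x ^ 2 + ρ ^ 2))))) =
      ENNReal.ofReal (exp (-(a * |x|)) / a) := by
  set g : ℝ → ℝ := fun ρ => -(exp (-(a * √(x ^ 2 + ρ ^ 2))) / a) with hg
  have hcont : Continuous g := by fun_prop
  have hderiv : ∀ ρ ∈ Set.Ioi (0 : ℝ), HasDerivAt g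
      (ρ * ((√(x ^ 2 + ρ ^ 2))⁻¹ * exp (-(a * √(x ^ 2 + ρ ^ 2))))) ρ := by
    intro ρ hρ
    have hρ' : 0 < ρ := hρ
    have hpos : 0 < x ^ 2 + ρ ^ 2 := by positivity
    have hsq : HasDerivAt (fun ρ : ℝ => x ^ 2 + ρ ^ 2) (2 * ρ) ρ := by
      simpa using (hasDerivAt_pow 2 ρ).const_add (x ^ 2)
    have h := (((hsq.sqrt hpos.ne').const_mul a).neg.exp.div_const a).neg
    refine h.congr_deriv ?_
    have : √(x ^ 2 + ρ ^ 2) ≠ 0 := (Real.sqrt_pos.2 hpos).ne'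
    simp only [Pi.neg_apply]
    field_simp
  have hnonneg : ∀ ρ ∈ Set.Ioi (0 : ℝ),
      0 ≤ ρ * ((√(x ^ 2 + ρ ^ 2))⁻¹ * exp (-(a * √(x ^ 2 + ρ ^ 2)))) := by
    intro ρ hρ
    have hρ' : 0 < ρ := hρ
    positivity
  have hlim : Filter.Tendsto g Filter.atTop (nhds 0) := by
    have hsqrt : Filter.Tendsto (fun ρ : ℝ => √(x ^ 2 + ρ ^ 2)) Filter.atTop Filter.atTop :=
      Filter.tendsto_atTop_mono
        (fun ρ => Real.le_sqrt_of_sq_le (le_add_of_nonneg_left (sq_nonneg x))) Filter.tendsto_id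
    have h := ((Real.tendsto_exp_neg_atTop_nhds_zero.comp
      (hsqrt.const_mul_atTop ha)).div_const a).neg
    simpa [hg, Function.comp_def] using h
  have hint := integrableOn_Ioi_deriv_of_nonneg hcont.continuousWithinAt hderiv hnonneg hlim
  rw [← ofReal_integral_eq_lintegral_ofReal hint
    ((ae_restrict_iff' measurableSet_Ioi).2 (Filter.Eventually.of_forall hnonneg)),
    integral_Ioi_of_hasDerivAt_of_nonneg hcont.continuousWithinAt hderiv hnonneg hlim]
  simp [hg, Real.sqrt_sq_eq_abs]

lemma lintegral_planar_exp_neg_sqrt {a : ℝ} (ha : 0 < a) (x : ℝ) :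
    ∫⁻ q : ℝ × ℝ, ENNReal.ofReal ((√(x ^ 2 + (q.1 ^ 2 + q.2 ^ 2)))⁻¹ *
        exp (-(a * √(x ^ 2 + (q.1 ^ 2 + q.2 ^ 2))))) =
      ENNReal.ofReal (2 * π / a) * ENNReal.ofReal (exp (-(a * |x|))) := by
  rw [← lintegral_comp_polarCoord_symm]
  have hcoord : ∀ p : ℝ × ℝ, (p.1 * cos p.2) ^ 2 + (p.1 * sin p.2) ^ 2 = p.1 ^ 2 := fun p => by
    linear_combination p.1 ^ 2 * Real.sin_sq_add_cos_sq p.2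
  have hpt : ∀ p ∈ polarCoord.target, ENNReal.ofReal p.1 •
      ENNReal.ofReal ((√(x ^ 2 + ((polarCoord.symm p).1 ^ 2 + (polarCoord.symm p).2 ^ 2)))⁻¹ *
        exp (-(a * √(x ^ 2 + ((polarCoord.symm p).1 ^ 2 + (polarCoord.symm p).2 ^ 2))))) =
      ENNReal.ofReal (p.1 * ((√(x ^ 2 + p.1 ^ 2))⁻¹ * exp (-(a * √(x ^ 2 + p.1 ^ 2))))) * 1 := by
    intro p hp
    have hp1 : 0 < p.1 := hp.1
    simp only [polarCoord_symm_apply, hcoord, smul_eq_mul, mul_one]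
    rw [← ENNReal.ofReal_mul hp1.le]
  rw [setLIntegral_congr_fun polarCoord.open_target.measurableSet hpt, polarCoord_target,
    Measure.volume_eq_prod, ← Measure.prod_restrict,
    lintegral_prod_mul (f := fun ρ : ℝ => ENNReal.ofReal
      (ρ * ((√(x ^ 2 + ρ ^ 2))⁻¹ * exp (-(a * √(x ^ 2 + ρ ^ 2)))))) (g := fun _ => 1)
      (by fun_prop) (by fun_prop), lintegral_radial_exp_neg_sqrt ha]
  rw [lintegral_one, Measure.restrict_apply_univ, Real.volume_Ioo,
    ← ENNReal.ofReal_mul (by positivity), ← ENNReal.ofReal_mul (by positivity)]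
  congr 1
  ring

lemma lintegral_exp_mul_sub_mul_abs {a b : ℝ} (hab : |b| < a) :
    ∫⁻ x : ℝ, ENNReal.ofReal (exp (-(a * |x|)) * exp (b * x)) =
      ENNReal.ofReal (2 * a / (a ^ 2 - b ^ 2)) := by
  obtain ⟨h1, h2⟩ := abs_lt.1 hab
  have hp : 0 < b + a := by linarith
  have hm : b - a < 0 := by linarith
  have hIic : ∀ x ∈ Set.Iic (0 : ℝ), ENNReal.ofReal (exp (-(a * |x|)) * exp (b * x)) =
      ENNReal.ofReal (exp ((b + a) * x)) := by
    intro x hx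
    rw [abs_of_nonpos hx, ← Real.exp_add]
    ring_nf
  have hIoi : ∀ x ∈ Set.Ioi (0 : ℝ), ENNReal.ofReal (exp (-(a * |x|)) * exp (b * x)) =
      ENNReal.ofReal (exp ((b - a) * x)) := by
    intro x hx
    rw [abs_of_pos hx, ← Real.exp_add]
    ring_nf
  rw [← setLIntegral_univ, ← Set.Iic_union_Ioi (a := (0 : ℝ)),
    lintegral_union measurableSet_Ioi (Set.Iic_disjoint_Ioi le_rfl),
    setLIntegral_congr_fun measurableSet_Iic hIic, setLIntegral_congr_fun measurableSet_Ioi hIoi,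
    ← ofReal_integral_eq_lintegral_ofReal (integrableOn_exp_mul_Iic hp 0)
      (Filter.Eventually.of_forall fun _ => (exp_pos _).le),
    ← ofReal_integral_eq_lintegral_ofReal (integrableOn_exp_mul_Ioi hm 0)
      (Filter.Eventually.of_forall fun _ => (exp_pos _).le),
    integral_exp_mul_Iic hp, integral_exp_mul_Ioi hm, mul_zero, mul_zero, Real.exp_zero,
    ← ENNReal.ofReal_add (by positivity) (div_nonneg_of_nonpos (by norm_num) hm.le)]
  congr 1
  have hm' : a - b ≠ 0 := by linarith
  have : a ^ 2 - b ^ 2 ≠ 0 := by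
    rw [sq_sub_sq]
    exact mul_ne_zero (by linarith) hm'
  field_simp [hm.ne]
  ring

lemma exists_orthonormalBasis_eq_norm_smul {E : Type*} [NormedAddCommGroup E]
    [InnerProductSpace ℝ E] [FiniteDimensional ℝ E] {ι : Type*} [Fintype ι]
    (h : Module.finrank ℝ E = Fintype.card ι) (i : ι) (v : E) :
    ∃ b : OrthonormalBasis ι ℝ E, v = ‖v‖ • b i := by
  rcases eq_or_ne v 0 with rfl | hv
  · obtain ⟨b, -⟩ := Orthonormal.exists_orthonormalBasis_extension_of_card_eq h
      (v := fun _ => (0 : E)) (s := ∅) ⟨fun j => j.2.elim, fun j => j.2.elim⟩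
    exact ⟨b, by simp⟩
  · have hn : ‖v‖ ≠ 0 := norm_ne_zero_iff.2 hv
    obtain ⟨b, hb⟩ := Orthonormal.exists_orthonormalBasis_extension_of_card_eq h
      (v := fun _ => ‖v‖⁻¹ • v) (s := {i})
      ⟨fun j => by simp [norm_smul, hn],
        fun j k hjk => (hjk (Subsingleton.elim j k)).elim⟩
    exact ⟨b, by rw [hb i rfl, smul_smul, mul_inv_cancel₀ hn, one_smul]⟩

lemma lintegral_euclideanSpace_fin_three (f : EuclideanSpace ℝ (Fin 3) → ENNReal)
    (hf : Measurable f) :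
    ∫⁻ p, f p = ∫⁻ x : ℝ, ∫⁻ q : ℝ × ℝ, f !₂[x, q.1, q.2] := by
  have e₁ := (volume_preserving_piFinSuccAbove (fun _ : Fin 3 => ℝ) 0).symm
  have e₂ := (MeasurePreserving.id (volume : Measure ℝ)).prod
    (volume_preserving_finTwoArrow ℝ).symm
  rw [← (PiLp.volume_preserving_toLp (Fin 3)).lintegral_comp hf,
    ← e₁.lintegral_comp (by fun_prop), Measure.volume_eq_prod, ← e₂.lintegral_comp (by fun_prop),
    lintegral_prod _ (by fun_prop)]
  refine lintegral_congr fun x => lintegral_congr fun q => ?_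
  congr 2
  ext i
  fin_cases i <;> rfl

lemma lintegral_inv_norm_mul_exp_neg {a : ℝ} (v : EuclideanSpace ℝ (Fin 3)) (hv : ‖v‖ < a) :
    ∫⁻ p : EuclideanSpace ℝ (Fin 3),
      ENNReal.ofReal (‖p‖⁻¹ * exp (-(a * ‖p‖ - ⟪v, p⟫))) =
      ENNReal.ofReal (4 * π / (a ^ 2 - ‖v‖ ^ 2)) := by
  have ha : 0 < a := (norm_nonneg v).trans_lt hv
  obtain ⟨b, hb⟩ := exists_orthonormalBasis_eq_norm_smul (ι := Fin 3) (by simp) 0 v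
  have hinner : ∀ y, ⟪v, b.repr.symm y⟫ = ‖v‖ * y 0 := fun y => by
    conv_lhs => rw [hb]
    rw [inner_smul_left, ← b.repr_apply_apply]
    simp
  rw [← b.measurePreserving_repr_symm.lintegral_comp (by fun_prop)]
  simp only [LinearIsometryEquiv.norm_map, hinner]
  rw [lintegral_euclideanSpace_fin_three _ (by fun_prop)]
  have hinside : ∀ x : ℝ, ∫⁻ q : ℝ × ℝ,
      ENNReal.ofReal (‖!₂[x, q.1, q.2]‖⁻¹ *
        exp (-(a * ‖!₂[x, q.1, q.2]‖ - ‖v‖ * !₂[x, q.1, q.2] 0))) =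
      ENNReal.ofReal (2 * π / a) *
        ENNReal.ofReal (exp (-(a * |x|)) * exp (‖v‖ * x)) := fun x => by
    rw [ENNReal.ofReal_mul (exp_pos _).le, ← mul_assoc, ← lintegral_planar_exp_neg_sqrt ha,
      ← lintegral_mul_const _ (by fun_prop)]
    refine lintegral_congr fun q => ?_
    rw [← ENNReal.ofReal_mul (by positivity), mul_assoc, ← Real.exp_add]
    simp [EuclideanSpace.norm_eq, Fin.sum_univ_three, add_assoc, sub_eq_add_neg, add_comm]
  simp only [hinside]
  rw [lintegral_const_mul _ (by fun_prop),
    lintegral_exp_mul_sub_mul_abs (by rwa [abs_of_nonneg (norm_nonneg v)]),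
    ← ENNReal.ofReal_mul (by positivity)]
  congr 1
  have : a ^ 2 - ‖v‖ ^ 2 ≠ 0 := by nlinarith [norm_nonneg v]
  field_simp
  ring

lemma hasSum_exp_neg_succ_mul {s : ℝ} (hs : 0 < s) :
    HasSum (fun n : ℕ => exp (-((n + 1) * s))) (exp s - 1)⁻¹ := by
  have h := (hasSum_geometric_of_lt_one (exp_pos (-s)).le (by simpa using hs)).mul_left (exp (-s))
  have hterm : ∀ n : ℕ, exp (-((n + 1) * s)) = exp (-s) * exp (-s) ^ n := fun n => by
    rw [← Real.exp_nat_mul, ← Real.exp_add]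
    ring_nf
  have hval : (exp s - 1)⁻¹ = exp (-s) * (1 - exp (-s))⁻¹ := by
    rw [← inv_inv (exp (-s)), ← mul_inv, ← Real.exp_neg, neg_neg, inv_inj, mul_sub,
      mul_one, mul_inv_cancel₀ (exp_pos s).ne']
  simpa only [hterm, hval] using h

lemma hasSum_one_div_succ_sq : HasSum (fun n : ℕ => 1 / ((n : ℝ) + 1) ^ 2) (π ^ 2 / 6) := by
  simpa using (hasSum_nat_add_iff' 1).2 hasSum_zeta_two

lemma mul_norm_sub_inner_pos {E : Type*} [NormedAddCommGroup E] [InnerProductSpace ℝ E]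
    {a : ℝ} {v p : E} (hv : ‖v‖ < a) (hp : p ≠ 0) : 0 < a * ‖p‖ - ⟪v, p⟫ := by
  have h1 := real_inner_le_norm v p
  have h2 := mul_lt_mul_of_pos_right hv (norm_pos_iff.2 hp)
  linarith

lemma lintegral_boseEinstein {a : ℝ} (v : EuclideanSpace ℝ (Fin 3)) (hv : ‖v‖ < a) :
    ∫⁻ p : EuclideanSpace ℝ (Fin 3),
      ENNReal.ofReal (‖p‖⁻¹ * (exp (a * ‖p‖ - ⟪v, p⟫) - 1)⁻¹) =
      ENNReal.ofReal (4 * π / (a ^ 2 - ‖v‖ ^ 2) * (π ^ 2 / 6)) := by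
  have hden : 0 < a ^ 2 - ‖v‖ ^ 2 := by nlinarith [norm_nonneg v]
  have hseries : ∀ p : EuclideanSpace ℝ (Fin 3),
      ENNReal.ofReal (‖p‖⁻¹ * (exp (a * ‖p‖ - ⟪v, p⟫) - 1)⁻¹) =
      ∑' n : ℕ, ENNReal.ofReal (‖p‖⁻¹ * exp (-((n + 1) * (a * ‖p‖ - ⟪v, p⟫)))) := fun p => by
    rcases eq_or_ne p 0 with rfl | hp
    · simp
    · have h := (hasSum_exp_neg_succ_mul (mul_norm_sub_inner_pos hv hp)).mul_left ‖p‖⁻¹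
      rw [← h.tsum_eq, ENNReal.ofReal_tsum_of_nonneg (fun n => by positivity) h.summable]
  simp only [hseries]
  rw [lintegral_tsum fun n => by fun_prop]
  have hterm : ∀ n : ℕ, ∫⁻ p : EuclideanSpace ℝ (Fin 3),
      ENNReal.ofReal (‖p‖⁻¹ * exp (-((n + 1) * (a * ‖p‖ - ⟪v, p⟫)))) =
      ENNReal.ofReal (4 * π / (a ^ 2 - ‖v‖ ^ 2) * (1 / ((n : ℝ) + 1) ^ 2)) := fun n => by
    have hn : (0 : ℝ) < n + 1 := by positivity
    have hnorm : ‖((n : ℝ) + 1) • v‖ = (n + 1) * ‖v‖ := by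
      rw [norm_smul, Real.norm_of_nonneg hn.le]
    have h := lintegral_inv_norm_mul_exp_neg (a := (n + 1) * a) (((n : ℝ) + 1) • v)
      (by rw [hnorm]; exact mul_lt_mul_of_pos_left hv hn)
    simp only [real_inner_smul_left, hnorm, mul_assoc, ← mul_sub] at h
    rw [h]
    congr 1
    rw [mul_pow, mul_pow, ← mul_sub]
    field_simp
  have hsum := hasSum_one_div_succ_sq.mul_left (4 * π / (a ^ 2 - ‖v‖ ^ 2))
  simp only [hterm]
  rw [← hsum.tsum_eq, ENNReal.ofReal_tsum_of_nonneg (fun n => by positivity) hsum.summable]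

/-- Lorentz-covariant form of the thermal function of the Wick square:
    for 𝛃 = (β₀, 𝛃⃗) future-directed timelike,
    (2π)⁻³ ∫_{ℝ³} ‖p‖⁻¹ (e^{β₀‖p‖ − ⟨𝛃⃗,p⟩} − 1)⁻¹ dp = 1/(12(β₀² − ‖𝛃⃗‖²)). -/
theorem wick_square_thermal_function_covariant
    (β₀ : ℝ) (βv : EuclideanSpace ℝ (Fin 3)) (hβ : β₀ > ‖βv‖) :
    Integrable (fun p : EuclideanSpace ℝ (Fin 3) =>
      ‖p‖⁻¹ * (Real.exp (β₀ * ‖p‖ - ⟪βv, p⟫) - 1)⁻¹) ∧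
    ((2 * Real.pi) ^ 3)⁻¹ *
      (∫ p : EuclideanSpace ℝ (Fin 3),
        ‖p‖⁻¹ * (Real.exp (β₀ * ‖p‖ - ⟪βv, p⟫) - 1)⁻¹) =
      1 / (12 * (β₀ ^ 2 - ‖βv‖ ^ 2)) := by
  set f : EuclideanSpace ℝ (Fin 3) → ℝ := fun p =>
    ‖p‖⁻¹ * (Real.exp (β₀ * ‖p‖ - ⟪βv, p⟫) - 1)⁻¹ with hf
  have hmeas : AEStronglyMeasurable f := by
    have : Measurable f := by fun_prop
    exact this.aestronglyMeasurable
  have hnonneg : 0 ≤ᵐ[volume] f := Filter.Eventually.of_forall fun p => by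
    rcases eq_or_ne p 0 with rfl | hp
    · simp [hf]
    · have := Real.one_lt_exp_iff.2 (mul_norm_sub_inner_pos hβ hp)
      exact mul_nonneg (by positivity) (inv_nonneg.2 (by linarith))
  have hden : 0 < β₀ ^ 2 - ‖βv‖ ^ 2 := by nlinarith [norm_nonneg βv]
  have hlint := lintegral_boseEinstein βv hβ
  refine ⟨⟨hmeas, (hasFiniteIntegral_iff_ofReal hnonneg).2 (hlint ▸ ENNReal.ofReal_lt_top)⟩, ?_⟩
  rw [integral_eq_lintegral_of_nonneg_ae hnonneg hmeas, hlint,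
    ENNReal.toReal_ofReal (by positivity)]
  field_simp
  ring
end

section
/- For every β > 0, the function p ↦ ‖p‖ (e^{β‖p‖} − 1)⁻¹ is integrable on ℝ³ and (2π)⁻³ ∫_{ℝ³} ‖p‖ (e^{β‖p‖} − 1)⁻¹ dp = π²/(30 β⁴). (This is the thermal energy density E₀₀(β) of the massless Klein–Gordon field in its rest frame — the Stefan–Boltzmann law.) -/
open MeasureTheory Real

/-- The Bose integral `∫₀^∞ r³ / (e^{β r} - 1) dr = π⁴ / (15 β⁴)`. -/
lemma integral_pow_three_mul_inv_exp_sub_one {β : ℝ} (hβ : 0 < β) :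
    ∫ r in Set.Ioi (0 : ℝ), r ^ 3 * (Real.exp (β * r) - 1)⁻¹ = Real.pi ^ 4 / (15 * β ^ 4) := by
  have hterm (n : ℕ) : ∫ r in Set.Ioi (0 : ℝ), r ^ 3 * Real.exp (-(β * (n + 1) * r)) =
      6 / β ^ 4 * (1 / ((n + 1 : ℕ) : ℝ) ^ 4) := by
    have h := Real.integral_rpow_mul_exp_neg_mul_Ioi (a := 4) (r := β * (n + 1))
      (by norm_num) (by positivity)
    have hG : Real.Gamma 4 = 6 := by
      rw [show (4 : ℝ) = (3 : ℕ) + 1 by norm_num, Real.Gamma_nat_eq_factorial]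
      norm_num [Nat.factorial]
    rw [hG, show (4 : ℝ) - 1 = (3 : ℕ) by norm_num, show (4 : ℝ) = (4 : ℕ) by norm_num] at h
    simp only [Real.rpow_natCast] at h
    rw [h]
    push_cast
    field_simp
  have hzeta : HasSum (fun n : ℕ => 6 / β ^ 4 * (1 / ((n + 1 : ℕ) : ℝ) ^ 4))
      (6 / β ^ 4 * (Real.pi ^ 4 / 90)) := by
    refine HasSum.mul_left _ ?_
    simpa using (hasSum_nat_add_iff' 1).2 hasSum_zeta_four
  have hint (n : ℕ) : IntegrableOn (fun r : ℝ => r ^ 3 * Real.exp (-(β * (n + 1) * r)))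
      (Set.Ioi 0) := by
    refine Integrable.of_integral_ne_zero ?_
    rw [hterm]
    positivity
  have hnorm (n : ℕ) : ∫ r in Set.Ioi (0 : ℝ), ‖r ^ 3 * Real.exp (-(β * (n + 1) * r))‖ =
      6 / β ^ 4 * (1 / ((n + 1 : ℕ) : ℝ) ^ 4) := by
    rw [← hterm]
    refine setIntegral_congr_fun measurableSet_Ioi fun r hr => ?_
    have hr : 0 < r := hr
    exact Real.norm_of_nonneg (by positivity)
  have hsum := hasSum_integral_of_summable_integral_norm hint
    (by simpa only [hnorm] using hzeta.summable)
  simp only [hterm] at hsum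
  have heq := hsum.unique hzeta
  rw [show Real.pi ^ 4 / (15 * β ^ 4) = 6 / β ^ 4 * (Real.pi ^ 4 / 90) by field_simp; norm_num,
    ← heq]
  refine setIntegral_congr_fun measurableSet_Ioi fun r hr => ?_
  have hr : 0 < r := hr
  have hlt : Real.exp (-(β * r)) < 1 := by simpa using mul_pos hβ hr
  have hgeom : HasSum (fun n : ℕ => r ^ 3 * Real.exp (-(β * (n + 1) * r)))
      (r ^ 3 * (Real.exp (-(β * r)) * (1 - Real.exp (-(β * r)))⁻¹)) := by
    refine HasSum.mul_left _ ?_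
    convert (hasSum_geometric_of_lt_one (Real.exp_pos _).le hlt).mul_left
      (Real.exp (-(β * r))) using 2 with n
    rw [← Real.exp_nat_mul, ← Real.exp_add]
    ring_nf
  rw [hgeom.tsum_eq, Real.exp_neg, ← mul_inv]
  congr 2
  field_simp

/-- Stefan–Boltzmann law: the thermal energy density of the massless
    Klein–Gordon field in its rest frame,
    E₀₀(β) = (2π)⁻³ ∫_{ℝ³} ‖p‖ (e^{β‖p‖} − 1)⁻¹ dp = π²/(30β⁴). -/
theorem stefan_boltzmann (β : ℝ) (hβ : 0 < β) :
    Integrable (fun p : EuclideanSpace ℝ (Fin 3) =>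
      ‖p‖ * (Real.exp (β * ‖p‖) - 1)⁻¹) ∧
    ((2 * Real.pi) ^ 3)⁻¹ *
      (∫ p : EuclideanSpace ℝ (Fin 3), ‖p‖ * (Real.exp (β * ‖p‖) - 1)⁻¹) =
      Real.pi ^ 2 / (30 * β ^ 4) := by
  have hmain : ∫ p : EuclideanSpace ℝ (Fin 3), ‖p‖ * (Real.exp (β * ‖p‖) - 1)⁻¹ =
      4 * Real.pi * (Real.pi ^ 4 / (15 * β ^ 4)) := by
    rw [integral_fun_norm_addHaar volume (fun r : ℝ => r * (Real.exp (β * r) - 1)⁻¹),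
      ← integral_pow_three_mul_inv_exp_sub_one hβ]
    have hball : volume.real (Metric.ball (0 : EuclideanSpace ℝ (Fin 3)) 1) =
        Real.pi * 4 / 3 := by
      rw [Measure.real, EuclideanSpace.volume_ball_fin_three]
      simp only [ENNReal.ofReal_one, one_pow, one_mul]
      exact ENNReal.toReal_ofReal (by positivity)
    rw [hball]
    simp only [finrank_euclideanSpace, Fintype.card_fin, nsmul_eq_mul, smul_eq_mul,
      Nat.add_one_sub_one, ← mul_assoc, ← pow_succ]
    push_cast
    ring
  refine ⟨Integrable.of_integral_ne_zero ?_, ?_⟩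
  · rw [hmain]
    positivity
  · rw [hmain]
    field_simp
    norm_num
end

section
/- For every β > 0 and all i, j ∈ {1,2,3}, the function p ↦ (p_i p_j/‖p‖)(e^{β‖p‖} − 1)⁻¹ is integrable on ℝ³ and (2π)⁻³ ∫_{ℝ³} (p_i p_j/‖p‖)(e^{β‖p‖} − 1)⁻¹ dp = δ_{ij} · π²/(90 β⁴). (These are the spatial components E_{ij}(β) = δ_{ij} π²/(90β⁴) of the thermal stress-energy tensor of the massless field in its rest frame: the thermal pressure.) -/
open MeasureTheory Real

/-- Off-diagonal second moments of a radial weight vanish. -/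
lemma integral_coord_mul_coord_mul_radial_of_ne {ι : Type*} [Fintype ι]
    (g : ℝ → ℝ) {i j : ι} (hij : i ≠ j) :
    ∫ p : EuclideanSpace ℝ ι, p i * p j * g ‖p‖ = 0 := by
  classical
  let e : EuclideanSpace ℝ ι ≃ₗᵢ[ℝ] EuclideanSpace ℝ ι :=
    LinearIsometryEquiv.piLpCongrRight 2
      (fun k => if k = i then LinearIsometryEquiv.neg ℝ else LinearIsometryEquiv.refl ℝ ℝ)
  have h := e.measurePreserving.integral_comp e.toHomeomorph.measurableEmbedding
    (fun p : EuclideanSpace ℝ ι => p i * p j * g ‖p‖)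
  have hi (p : EuclideanSpace ℝ ι) : e p i = -p i := by simp [e]
  have hj (p : EuclideanSpace ℝ ι) : e p j = p j := by simp [e, hij.symm]
  simp only [hi, hj, LinearIsometryEquiv.norm_map, neg_mul, integral_neg] at h
  linarith

/-- All diagonal second moments of a radial weight agree. -/
lemma integral_coord_mul_self_mul_radial_eq {ι : Type*} [Fintype ι]
    (g : ℝ → ℝ) (i j : ι) :
    ∫ p : EuclideanSpace ℝ ι, p i * p i * g ‖p‖ =
      ∫ p : EuclideanSpace ℝ ι, p j * p j * g ‖p‖ := by
  classical
  let e : EuclideanSpace ℝ ι ≃ₗᵢ[ℝ] EuclideanSpace ℝ ι :=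
    LinearIsometryEquiv.piLpCongrLeft 2 ℝ ℝ (Equiv.swap i j)
  have h := e.measurePreserving.integral_comp e.toHomeomorph.measurableEmbedding
    (fun p : EuclideanSpace ℝ ι => p j * p j * g ‖p‖)
  have hj (p : EuclideanSpace ℝ ι) : e p j = p i := by
    simp [e, LinearIsometryEquiv.piLpCongrLeft_apply, Equiv.piCongrLeft'_apply]
  simpa only [hj, LinearIsometryEquiv.norm_map] using h

lemma integrableOn_cube_mul_exp_neg_mul {r : ℝ} (hr : 0 < r) :
    IntegrableOn (fun y : ℝ => y ^ 3 * exp (-(r * y))) (Set.Ioi 0) := by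
  have h := integrableOn_rpow_mul_exp_neg_mul_rpow (p := 1) (s := 3) (b := r)
    (by norm_num) one_pos hr
  refine h.congr_fun (fun y _ => ?_) measurableSet_Ioi
  simp only [rpow_one, neg_mul]
  norm_cast

lemma integral_cube_mul_exp_neg_mul {r : ℝ} (hr : 0 < r) :
    ∫ y in Set.Ioi (0 : ℝ), y ^ 3 * exp (-(r * y)) = 6 / r ^ 4 := by
  have h := integral_rpow_mul_exp_neg_mul_Ioi (a := 4) (by norm_num) hr
  have hG : Gamma 4 = 6 := by
    rw [show (4 : ℝ) = (3 : ℕ) + 1 by norm_num, Gamma_nat_eq_factorial]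
    norm_num [Nat.factorial]
  rw [hG] at h
  norm_num at h
  rw [h]
  field_simp

lemma hasSum_exp_neg_mul_bose {x : ℝ} (hx : 0 < x) :
    HasSum (fun n : ℕ => exp (-((n + 1) * x))) (exp x - 1)⁻¹ := by
  have h := (hasSum_geometric_of_lt_one (exp_pos (-x)).le
    (exp_lt_one_iff.2 (neg_lt_zero.2 hx))).mul_left (exp (-x))
  have h1 : (1 : ℝ) < exp x := one_lt_exp_iff.2 hx
  convert! h using 1
  · ext n
    rw [← exp_nat_mul, ← exp_add]
    ring_nf
  · rw [exp_neg]
    have : exp x - 1 ≠ 0 := by linarith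
    field_simp

/-- The Planck integral. -/
lemma integral_cube_mul_bose {β : ℝ} (hβ : 0 < β) :
    ∫ y in Set.Ioi (0 : ℝ), y ^ 3 * (exp (β * y) - 1)⁻¹ = π ^ 4 / (15 * β ^ 4) := by
  have hr (n : ℕ) : 0 < (n + 1) * β := by positivity
  have hz : HasSum (fun n : ℕ => 6 / ((n + 1) * β) ^ 4) (π ^ 4 / (15 * β ^ 4)) := by
    have h := ((hasSum_nat_add_iff' 1).2 hasSum_zeta_four).mul_left (6 / β ^ 4)
    convert! h using 1
    · ext n
      push_cast
      field_simp
    · simp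
      field_simp
      norm_num
  have hn (n : ℕ) : ∫ y in Set.Ioi (0 : ℝ), ‖y ^ 3 * exp (-((n + 1) * β * y))‖ =
      6 / ((n + 1) * β) ^ 4 := by
    rw [← integral_cube_mul_exp_neg_mul (hr n)]
    refine setIntegral_congr_fun measurableSet_Ioi fun y hy => ?_
    have : 0 < y := hy
    exact norm_of_nonneg (by positivity)
  have h := hasSum_integral_of_summable_integral_norm
    (μ := volume.restrict (Set.Ioi (0 : ℝ)))
    (F := fun (n : ℕ) y => y ^ 3 * exp (-((n + 1) * β * y)))
    (fun n => integrableOn_cube_mul_exp_neg_mul (hr n))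
    (by simpa only [hn] using hz.summable)
  simp only [integral_cube_mul_exp_neg_mul (hr _)] at h
  rw [hz.unique h]
  refine setIntegral_congr_fun measurableSet_Ioi fun y hy => ?_
  have hs := (hasSum_exp_neg_mul_bose (mul_pos hβ hy)).mul_left (y ^ 3)
  simp only [← mul_assoc] at hs ⊢
  exact hs.tsum_eq.symm

lemma integrableOn_cube_mul_bose {β : ℝ} (hβ : 0 < β) :
    IntegrableOn (fun y : ℝ => y ^ 3 * (exp (β * y) - 1)⁻¹) (Set.Ioi 0) := by
  refine Integrable.of_integral_ne_zero ?_
  rw [integral_cube_mul_bose hβ]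
  positivity

lemma integrable_norm_mul_bose {β : ℝ} (hβ : 0 < β) :
    Integrable (fun p : EuclideanSpace ℝ (Fin 3) => ‖p‖ * (exp (β * ‖p‖) - 1)⁻¹) := by
  refine (integrable_fun_norm_addHaar volume
    (f := fun y => y * (exp (β * y) - 1)⁻¹)).2 ?_
  refine (integrableOn_cube_mul_bose hβ).congr_fun (fun y _ => ?_) measurableSet_Ioi
  simp only [finrank_euclideanSpace_fin, smul_eq_mul]
  ring

lemma integral_norm_mul_bose {β : ℝ} (hβ : 0 < β) :
    ∫ p : EuclideanSpace ℝ (Fin 3), ‖p‖ * (exp (β * ‖p‖) - 1)⁻¹ =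
      4 * π * (π ^ 4 / (15 * β ^ 4)) := by
  rw [integral_fun_norm_addHaar volume (fun y => y * (exp (β * y) - 1)⁻¹),
    ← integral_cube_mul_bose hβ]
  have hI : ∫ y in Set.Ioi (0 : ℝ), y ^ (3 - 1) • (y * (exp (β * y) - 1)⁻¹) =
      ∫ y in Set.Ioi (0 : ℝ), y ^ 3 * (exp (β * y) - 1)⁻¹ := by
    congr 1
    ext y
    simp only [smul_eq_mul]
    ring
  have hB : volume.real (Metric.ball (0 : EuclideanSpace ℝ (Fin 3)) 1) = π * 4 / 3 := by
    rw [Measure.real, EuclideanSpace.volume_ball_fin_three]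
    simp only [ENNReal.ofReal_one, one_pow, one_mul]
    exact ENNReal.toReal_ofReal (by positivity)
  rw [finrank_euclideanSpace_fin, hI, hB]
  simp only [nsmul_eq_mul, smul_eq_mul]
  push_cast
  ring

lemma integrable_coord_mul_coord_mul_bose {β : ℝ} (hβ : 0 < β) (i j : Fin 3) :
    Integrable (fun p : EuclideanSpace ℝ (Fin 3) =>
      (p i * p j / ‖p‖) * (exp (β * ‖p‖) - 1)⁻¹) := by
  refine (integrable_norm_mul_bose hβ).mono'
    (Measurable.aestronglyMeasurable (by fun_prop)) (.of_forall fun p => ?_)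
  have hb : 0 ≤ (exp (β * ‖p‖) - 1)⁻¹ :=
    inv_nonneg.2 (sub_nonneg.2 (one_le_exp (by positivity)))
  rw [norm_mul, norm_of_nonneg hb, norm_div, norm_mul, norm_norm]
  gcongr
  refine div_le_of_le_mul₀ (norm_nonneg p) (norm_nonneg p) ?_
  gcongr <;> exact PiLp.norm_apply_le p _

/-- The spatial components of the thermal stress-energy tensor of the massless
    Klein–Gordon field in its rest frame (thermal pressure):
    E_{ij}(β) = (2π)⁻³ ∫_{ℝ³} (p_i p_j/‖p‖)(e^{β‖p‖} − 1)⁻¹ dp = δ_{ij} π²/(90β⁴). -/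
theorem thermal_pressure (β : ℝ) (hβ : 0 < β) (i j : Fin 3) :
    Integrable (fun p : EuclideanSpace ℝ (Fin 3) =>
      (p i * p j / ‖p‖) * (Real.exp (β * ‖p‖) - 1)⁻¹) ∧
    ((2 * Real.pi) ^ 3)⁻¹ *
      (∫ p : EuclideanSpace ℝ (Fin 3),
        (p i * p j / ‖p‖) * (Real.exp (β * ‖p‖) - 1)⁻¹) =
      (if i = j then (1 : ℝ) else 0) * (Real.pi ^ 2 / (90 * β ^ 4)) := by
  refine ⟨integrable_coord_mul_coord_mul_bose hβ i j, ?_⟩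
  have hradial (k l : Fin 3) (p : EuclideanSpace ℝ (Fin 3)) :
      (p k * p l / ‖p‖) * (exp (β * ‖p‖) - 1)⁻¹ =
        p k * p l * (fun r : ℝ => r⁻¹ * (exp (β * r) - 1)⁻¹) ‖p‖ := by
    simp only [div_eq_mul_inv, mul_assoc]
  split_ifs with hij
  · subst hij
    have hsum : ∑ k : Fin 3, ∫ p : EuclideanSpace ℝ (Fin 3),
        (p k * p k / ‖p‖) * (exp (β * ‖p‖) - 1)⁻¹ = 4 * π * (π ^ 4 / (15 * β ^ 4)) := by
      rw [← integral_norm_mul_bose hβ,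
        ← integral_finsetSum _ fun k _ => integrable_coord_mul_coord_mul_bose hβ k k]
      congr 1
      ext p
      rw [← Finset.sum_mul, ← Finset.sum_div]
      have hp : ∑ k, p k * p k = ‖p‖ * ‖p‖ := by
        simp only [← pow_two, EuclideanSpace.real_norm_sq_eq]
      rw [hp, mul_self_div_self]
    have heq (k : Fin 3) : ∫ p : EuclideanSpace ℝ (Fin 3),
        (p k * p k / ‖p‖) * (exp (β * ‖p‖) - 1)⁻¹ =
        ∫ p : EuclideanSpace ℝ (Fin 3), (p i * p i / ‖p‖) * (exp (β * ‖p‖) - 1)⁻¹ := by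
      simp only [hradial]
      exact integral_coord_mul_self_mul_radial_eq (fun r => r⁻¹ * (exp (β * r) - 1)⁻¹) k i
    simp only [heq, Finset.sum_const, Finset.card_univ, Fintype.card_fin, nsmul_eq_mul] at hsum
    push_cast at hsum
    rw [eq_div_of_mul_eq three_ne_zero ((mul_comm _ _).trans hsum)]
    field_simp
    norm_num
  · simp_rw [hradial]
    rw [integral_coord_mul_coord_mul_radial_of_ne (fun r => r⁻¹ * (exp (β * r) - 1)⁻¹) hij,
      mul_zero, zero_mul]
end

section
/- Let m ≥ 0, β > 0 and ω_p = √(‖p‖² + m²) for p ∈ ℝ³. For ξ ∈ ℝ⁴ and 0 < σ < β define F(ξ, σ) = (2π)⁻³ ∫_{ℝ³} (2ω_p)⁻¹ (1 − e^{−βω_p})⁻¹ ( e^{i(ω_p(ξ₀+iσ) − ⟨p,ξ⃗⟩)} + e^{−i(ω_p(ξ₀+iσ) − ⟨p,ξ⃗⟩)} e^{−βω_p} ) dp. Then the integral converges absolutely for every such (ξ,σ); for each fixed ξ⃗ ∈ ℝ³ the map z₀ ↦ F((Re z₀, ξ⃗), Im z₀) is holomorphic on the strip {z₀ ∈ ℂ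 : 0 < Im z₀ < β}; and for every compact K ⊂ (0, β) there is a constant C_K with |F(ξ,σ)| ≤ C_K for all ξ ∈ ℝ⁴ and σ ∈ K. (This establishes properties (i) and (ii) of the local KMS condition — holomorphy in the flat tube and the polynomial bound — for the thermal two-point function of the free field.) -/
open MeasureTheory Real Complex
open scoped RealInnerProductSpace

/-- Relativistic energy ω_p = √(‖p‖² + m²). -/
noncomputable def omega (m : ℝ) (p : EuclideanSpace ℝ (Fin 3)) : ℝ :=
  Real.sqrt (‖p‖ ^ 2 + m ^ 2)

/-- The momentum-space integrand of the analytically continued thermal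
    two-point function of the free field, at complex time ξ₀ + iσ. -/
noncomputable def thermalIntegrand (m β ξ₀ : ℝ) (ξv : EuclideanSpace ℝ (Fin 3))
    (σ : ℝ) (p : EuclideanSpace ℝ (Fin 3)) : ℂ :=
  (((2 * omega m p)⁻¹ * (1 - Real.exp (-β * omega m p))⁻¹ : ℝ) : ℂ) *
    (Complex.exp (Complex.I *
        ((omega m p : ℂ) * ((ξ₀ : ℂ) + (σ : ℂ) * Complex.I) - (⟪p, ξv⟫ : ℂ))) +
      Complex.exp (-(Complex.I *
        ((omega m p : ℂ) * ((ξ₀ : ℂ) + (σ : ℂ) * Complex.I) - (⟪p, ξv⟫ : ℂ)))) *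
        (Real.exp (-β * omega m p) : ℂ))

/-- The analytically continued thermal two-point function
    F(ξ, σ) = (2π)⁻³ ∫_{ℝ³} thermalIntegrand dp. -/
noncomputable def thermalF (m β ξ₀ : ℝ) (ξv : EuclideanSpace ℝ (Fin 3))
    (σ : ℝ) : ℂ :=
  (((2 * Real.pi) ^ 3)⁻¹ : ℝ) •
    ∫ p : EuclideanSpace ℝ (Fin 3), thermalIntegrand m β ξ₀ ξv σ p

lemma inv_one_sub_exp_neg_le {x : ℝ} (hx : 0 < x) : (1 - Real.exp (-x))⁻¹ ≤ 1 + x⁻¹ := by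
  have h : Real.exp (-x) ≤ (1 + x)⁻¹ := by
    rw [Real.exp_neg]
    exact inv_anti₀ (by positivity) (by linarith [Real.add_one_le_exp x])
  have h₂ : x / (1 + x) ≤ 1 - Real.exp (-x) := by
    have : x / (1 + x) = 1 - (1 + x)⁻¹ := by field_simp; ring
    linarith
  calc (1 - Real.exp (-x))⁻¹ ≤ (x / (1 + x))⁻¹ := inv_anti₀ (by positivity) h₂
    _ = 1 + x⁻¹ := by field_simp; ring

/-- A radial majorant of the thermal integrand for `σ ∈ [δ, β - δ]`. -/
noncomputable def thermalBound (β δ r : ℝ) : ℝ :=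
  (r⁻¹ + β⁻¹ * (r ^ 2)⁻¹) * Real.exp (-δ * r)

lemma thermalBound_anti {β δ : ℝ} (hβ : 0 < β) (hδ : 0 < δ) {r s : ℝ} (hr : 0 < r)
    (hrs : r ≤ s) : thermalBound β δ s ≤ thermalBound β δ r := by
  have hs : 0 < s := hr.trans_le hrs
  unfold thermalBound
  gcongr ?_ * Real.exp ?_
  · gcongr
  · nlinarith

lemma mul_thermalBound_anti {β δ : ℝ} (hβ : 0 < β) (hδ : 0 < δ) {r s : ℝ} (hr : 0 < r)
    (hrs : r ≤ s) : s * thermalBound β δ s ≤ r * thermalBound β δ r := by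
  have hs : 0 < s := hr.trans_le hrs
  have key (t : ℝ) (ht : 0 < t) :
      t * thermalBound β δ t = (1 + β⁻¹ * t⁻¹) * Real.exp (-δ * t) := by
    unfold thermalBound
    field_simp
  rw [key s hs, key r hr]
  gcongr ?_ * Real.exp ?_
  · gcongr
  · nlinarith

lemma integrableOn_pow_mul_exp_neg {δ : ℝ} (hδ : 0 < δ) (n : ℕ) :
    IntegrableOn (fun r : ℝ => r ^ n * Real.exp (-δ * r)) (Set.Ioi 0) := by
  have h := integrableOn_rpow_mul_exp_neg_mul_rpow (s := n) (p := 1) (b := δ)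
    (by linarith [n.cast_nonneg (α := ℝ)]) one_pos hδ
  simpa using h

lemma integrable_thermalBound_norm {β δ : ℝ} (hδ : 0 < δ) :
    Integrable (fun p : EuclideanSpace ℝ (Fin 3) => thermalBound β δ ‖p‖) := by
  rw [integrable_fun_norm_addHaar]
  refine ((integrableOn_pow_mul_exp_neg hδ 1).add
    ((integrableOn_pow_mul_exp_neg hδ 0).const_mul β⁻¹)).congr_fun (fun r hr => ?_)
    measurableSet_Ioi
  have hr : 0 < r := hr
  simp only [Pi.add_apply, finrank_euclideanSpace, Fintype.card_fin, thermalBound, smul_eq_mul,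
    Nat.reduceSub]
  field_simp

lemma integrable_norm_mul_thermalBound_norm {β δ : ℝ} (hδ : 0 < δ) :
    Integrable (fun p : EuclideanSpace ℝ (Fin 3) => ‖p‖ * thermalBound β δ ‖p‖) := by
  rw [integrable_fun_norm_addHaar volume (f := fun r => r * thermalBound β δ r)]
  refine ((integrableOn_pow_mul_exp_neg hδ 2).add
    ((integrableOn_pow_mul_exp_neg hδ 1).const_mul β⁻¹)).congr_fun (fun r hr => ?_)
    measurableSet_Ioi
  have hr : 0 < r := hr
  simp only [Pi.add_apply, finrank_euclideanSpace, Fintype.card_fin, thermalBound, smul_eq_mul,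
    Nat.reduceSub]
  field_simp

lemma norm_le_omega (m : ℝ) (p : EuclideanSpace ℝ (Fin 3)) : ‖p‖ ≤ omega m p :=
  Real.le_sqrt_of_sq_le (by nlinarith [sq_nonneg m])

@[fun_prop]
lemma continuous_omega (m : ℝ) : Continuous (omega m) := by
  unfold omega
  fun_prop

lemma measurable_thermalIntegrand (m β ξ₀ : ℝ) (ξv : EuclideanSpace ℝ (Fin 3)) (σ : ℝ) :
    Measurable (thermalIntegrand m β ξ₀ ξv σ) := by
  have h : Measurable (omega m) := (continuous_omega m).measurable
  unfold thermalIntegrand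
  fun_prop

/-- The statistical weight of the mode of energy `w`. -/
noncomputable def thermalWeight (β w : ℝ) : ℝ :=
  (2 * w)⁻¹ * (1 - Real.exp (-β * w))⁻¹

lemma norm_thermalWeight_mul_le {β δ w : ℝ} (hβ : 0 < β) (hw : 0 < w) {s : ℝ} {z a b : ℂ}
    (h₁ : δ ≤ z.im) (h₂ : z.im ≤ β - δ) (ha : ‖a‖ ≤ 1) (hb : ‖b‖ ≤ 1) :
    ‖(thermalWeight β w : ℂ) * (a * Complex.exp (Complex.I * (w * z - s)) +
      b * (Complex.exp (-(Complex.I * (w * z - s))) * (Real.exp (-β * w) : ℂ)))‖ ≤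
      thermalBound β δ w := by
  have e₁ : ‖a * Complex.exp (Complex.I * (w * z - s))‖ ≤ Real.exp (-δ * w) := by
    rw [norm_mul, Complex.norm_exp]
    refine (mul_le_of_le_one_left (Real.exp_pos _).le ha).trans (Real.exp_le_exp.2 ?_)
    simp
    nlinarith
  have e₂ : ‖b * (Complex.exp (-(Complex.I * (w * z - s))) * (Real.exp (-β * w) : ℂ))‖ ≤
      Real.exp (-δ * w) := by
    rw [norm_mul, norm_mul, Complex.norm_exp, Complex.norm_of_nonneg (Real.exp_pos _).le,
      ← Real.exp_add]
    refine (mul_le_of_le_one_left (Real.exp_pos _).le hb).trans (Real.exp_le_exp.2 ?_)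
    simp
    nlinarith
  have hexp : Real.exp (-β * w) < 1 := Real.exp_lt_one_iff.2 (by nlinarith [mul_pos hβ hw])
  have hinv : 0 ≤ (1 - Real.exp (-β * w))⁻¹ := inv_nonneg.2 (by linarith)
  have hinv' : (1 - Real.exp (-β * w))⁻¹ ≤ 1 + (β * w)⁻¹ := by
    rw [neg_mul]
    exact inv_one_sub_exp_neg_le (mul_pos hβ hw)
  rw [norm_mul, Complex.norm_of_nonneg (by unfold thermalWeight; positivity)]
  calc _ ≤ thermalWeight β w * (Real.exp (-δ * w) + Real.exp (-δ * w)) := by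
        refine mul_le_mul_of_nonneg_left ((norm_add_le _ _).trans (add_le_add e₁ e₂)) ?_
        unfold thermalWeight
        positivity
    _ = w⁻¹ * (1 - Real.exp (-β * w))⁻¹ * Real.exp (-δ * w) := by
        rw [thermalWeight, mul_inv]; ring
    _ ≤ w⁻¹ * (1 + (β * w)⁻¹) * Real.exp (-δ * w) := by gcongr
    _ = thermalBound β δ w := by
        unfold thermalBound
        field_simp

lemma thermalIntegrand_eq (m β : ℝ) (ξv : EuclideanSpace ℝ (Fin 3)) (z : ℂ)
    (p : EuclideanSpace ℝ (Fin 3)) :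
    thermalIntegrand m β z.re ξv z.im p = (thermalWeight β (omega m p) : ℂ) *
      (1 * Complex.exp (Complex.I * (omega m p * z - (⟪p, ξv⟫ : ℝ))) +
        1 * (Complex.exp (-(Complex.I * (omega m p * z - (⟪p, ξv⟫ : ℝ)))) *
          (Real.exp (-β * omega m p) : ℂ))) := by
  rw [thermalIntegrand, Complex.re_add_im, one_mul, one_mul, thermalWeight]

lemma norm_thermalIntegrand_le {m β δ : ℝ} (hβ : 0 < β) (hδ : 0 < δ) {z : ℂ}
    (ξv : EuclideanSpace ℝ (Fin 3)) (h₁ : δ ≤ z.im) (h₂ : z.im ≤ β - δ)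
    {p : EuclideanSpace ℝ (Fin 3)} (hp : p ≠ 0) :
    ‖thermalIntegrand m β z.re ξv z.im p‖ ≤ thermalBound β δ ‖p‖ := by
  have hp' := norm_pos_iff.2 hp
  rw [thermalIntegrand_eq]
  exact (norm_thermalWeight_mul_le hβ (hp'.trans_le (norm_le_omega m p)) h₁ h₂
    (by simp) (by simp)).trans (thermalBound_anti hβ hδ hp' (norm_le_omega m p))

lemma ae_norm_thermalIntegrand_le {m β δ : ℝ} (hβ : 0 < β) (hδ : 0 < δ) {z : ℂ}
    (ξv : EuclideanSpace ℝ (Fin 3)) (h₁ : δ ≤ z.im) (h₂ : z.im ≤ β - δ) :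
    ∀ᵐ p, ‖thermalIntegrand m β z.re ξv z.im p‖ ≤ thermalBound β δ ‖p‖ := by
  filter_upwards [Measure.ae_ne volume 0] with p hp
  exact norm_thermalIntegrand_le hβ hδ ξv h₁ h₂ hp

lemma integrable_thermalIntegrand {m β : ℝ} {z : ℂ} (ξv : EuclideanSpace ℝ (Fin 3))
    (h₁ : 0 < z.im) (h₂ : z.im < β) : Integrable (thermalIntegrand m β z.re ξv z.im) := by
  have hδ : 0 < min z.im (β - z.im) := lt_min h₁ (sub_pos.2 h₂)
  refine (integrable_thermalBound_norm (β := β) hδ).mono'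
    (measurable_thermalIntegrand ..).aestronglyMeasurable
    (ae_norm_thermalIntegrand_le (h₁.trans h₂) hδ ξv (min_le_left _ _) ?_)
  linarith [min_le_right z.im (β - z.im)]

lemma hasDerivAt_thermalIntegrand (m β : ℝ) (ξv : EuclideanSpace ℝ (Fin 3)) (z : ℂ)
    (p : EuclideanSpace ℝ (Fin 3)) :
    HasDerivAt (fun z : ℂ => thermalIntegrand m β z.re ξv z.im p)
      (omega m p * ((thermalWeight β (omega m p) : ℂ) *
      (Complex.I * Complex.exp (Complex.I * (omega m p * z - (⟪p, ξv⟫ : ℝ))) +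
        -Complex.I * (Complex.exp (-(Complex.I * (omega m p * z - (⟪p, ξv⟫ : ℝ)))) *
          (Real.exp (-β * omega m p) : ℂ))))) z := by
  simp_rw [thermalIntegrand_eq]
  have h : HasDerivAt (fun z : ℂ => Complex.I * (omega m p * z - (⟪p, ξv⟫ : ℝ)))
      (Complex.I * (omega m p * 1)) z :=
    (((hasDerivAt_id z).const_mul _).sub_const _).const_mul _
  refine (((h.cexp.const_mul 1).add
    ((h.neg.cexp.mul_const _).const_mul 1)).const_mul _).congr_deriv ?_
  simp only [Pi.neg_apply]
  ring

lemma differentiableAt_integral_thermalIntegrand {m β : ℝ} {z : ℂ}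
    (ξv : EuclideanSpace ℝ (Fin 3)) (h₁ : 0 < z.im) (h₂ : z.im < β) :
    DifferentiableAt ℂ (fun z : ℂ => ∫ p, thermalIntegrand m β z.re ξv z.im p) z := by
  have hβ := h₁.trans h₂
  obtain ⟨δ, hδ, hδ₁, hδ₂⟩ : ∃ δ, 0 < δ ∧ δ < z.im ∧ z.im < β - δ := by
    obtain ⟨δ, h, h'⟩ := exists_between (lt_min h₁ (sub_pos.2 h₂))
    exact ⟨δ, h, h'.trans_le (min_le_left _ _), by linarith [min_le_right z.im (β - z.im)]⟩
  have hs : {w : ℂ | δ < w.im ∧ w.im < β - δ} ∈ nhds z :=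
    ((isOpen_lt continuous_const Complex.continuous_im).inter
      (isOpen_lt Complex.continuous_im continuous_const)).mem_nhds ⟨hδ₁, hδ₂⟩
  refine (hasDerivAt_integral_of_dominated_loc_of_deriv_le (𝕜 := ℂ) hs
    (F := fun z p => thermalIntegrand m β z.re ξv z.im p)
    (bound := fun p => ‖p‖ * thermalBound β δ ‖p‖)
    (.of_forall fun w => (measurable_thermalIntegrand ..).aestronglyMeasurable)
    (integrable_thermalIntegrand ξv h₁ h₂) ?_ ?_
    (integrable_norm_mul_thermalBound_norm hδ)
    (.of_forall fun p w _ => hasDerivAt_thermalIntegrand m β ξv w p)).2.differentiableAt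
  · have h : Measurable (omega m) := (continuous_omega m).measurable
    unfold thermalWeight
    exact Measurable.aestronglyMeasurable (by fun_prop)
  · filter_upwards [Measure.ae_ne volume 0] with p hp w hw
    have hp' := norm_pos_iff.2 hp
    have hω := hp'.trans_le (norm_le_omega m p)
    rw [norm_mul, Complex.norm_of_nonneg hω.le]
    exact (mul_le_mul_of_nonneg_left (norm_thermalWeight_mul_le hβ hω hw.1.le hw.2.le
      (by simp) (by simp)) hω.le).trans (mul_thermalBound_anti hβ hδ hp' (norm_le_omega m p))

lemma norm_thermalF_le {m β δ σ : ℝ} (hβ : 0 < β) (hδ : 0 < δ) (ξ₀ : ℝ)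
    (ξv : EuclideanSpace ℝ (Fin 3)) (h₁ : δ ≤ σ) (h₂ : σ ≤ β - δ) :
    ‖thermalF m β ξ₀ ξv σ‖ ≤ ((2 * Real.pi) ^ 3)⁻¹ *
      ∫ p : EuclideanSpace ℝ (Fin 3), thermalBound β δ ‖p‖ := by
  rw [thermalF, norm_smul, Real.norm_of_nonneg (by positivity)]
  gcongr
  exact norm_integral_le_of_norm_le (integrable_thermalBound_norm hδ)
    (ae_norm_thermalIntegrand_le (z := ⟨ξ₀, σ⟩) hβ hδ ξv h₁ h₂)

/-- Properties (i) and (ii) of the local KMS condition for the thermal two-point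
    function of the free field: absolute convergence, holomorphy in the strip
    0 < Im z₀ < β, and a uniform bound for σ in compact subsets of (0, β). -/
theorem thermalF_holomorphic_and_bounded (m β : ℝ) (hm : 0 ≤ m) (hβ : 0 < β) :
    (∀ (ξ₀ : ℝ) (ξv : EuclideanSpace ℝ (Fin 3)) (σ : ℝ), 0 < σ → σ < β →
      Integrable (thermalIntegrand m β ξ₀ ξv σ)) ∧
    (∀ ξv : EuclideanSpace ℝ (Fin 3),
      DifferentiableOn ℂ (fun z : ℂ => thermalF m β z.re ξv z.im)
        {z : ℂ | 0 < z.im ∧ z.im < β}) ∧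
    (∀ K : Set ℝ, IsCompact K → K ⊆ Set.Ioo 0 β →
      ∃ C : ℝ, ∀ (ξ₀ : ℝ) (ξv : EuclideanSpace ℝ (Fin 3)), ∀ σ ∈ K,
        ‖thermalF m β ξ₀ ξv σ‖ ≤ C) := by
  refine ⟨fun ξ₀ ξv σ h₁ h₂ => integrable_thermalIntegrand (z := ⟨ξ₀, σ⟩) ξv h₁ h₂,
    fun ξv z hz => ?_, fun K hK hKβ => ?_⟩
  · exact ((differentiableAt_integral_thermalIntegrand ξv hz.1 hz.2).const_smul
      (((2 * Real.pi) ^ 3)⁻¹ : ℝ)).differentiableWithinAt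
  · obtain rfl | hne := K.eq_empty_or_nonempty
    · simp
    obtain ⟨τ, hτ, hmin⟩ := hK.exists_isMinOn (f := fun σ => min σ (β - σ)) hne (by fun_prop)
    refine ⟨_, fun ξ₀ ξv σ hσ => norm_thermalF_le (δ := min τ (β - τ)) hβ
      (lt_min (hKβ hτ).1 (sub_pos.2 (hKβ hτ).2)) ξ₀ ξv ?_ ?_⟩
    · exact (hmin hσ).trans (min_le_left _ _)
    · linarith [(hmin hσ).trans (min_le_right σ (β - σ))]
end

section
/- Let β > 0 and let z ∈ ℂ with 0 < Im z < β. Then (1/(4π²)) ∫₀^∞ ω ( e^{iωz} + e^{−iωz} e^{−βω} ) (1 − e^{−βω})⁻¹ dω = −(1/(4π²)) Σ_{n∈ℤ} (z + inβ)⁻², the integral converging absolutely and the sum converging absolutely. (Image-sum representation of the massless thermal two-point function restricted to the time axis.) -/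
open MeasureTheory Real Complex

theorem norm_ofReal_mul_cexp_neg_mul (a : ℂ) {ω : ℝ} (hω : 0 < ω) :
    ‖(ω : ℂ) * Complex.exp (-(a * ω))‖ = ω * Real.exp (-(a.re * ω)) := by
  rw [norm_mul, Complex.norm_exp, Complex.norm_real, Real.norm_of_nonneg hω.le]
  simp

theorem integrableOn_Ioi_mul_exp_neg_mul {r : ℝ} (hr : 0 < r) :
    IntegrableOn (fun ω : ℝ => ω * Real.exp (-(r * ω))) (Set.Ioi 0) := by
  simpa using integrableOn_rpow_mul_exp_neg_mul_rpow (p := 1) (s := 1) (by norm_num) one_pos hr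

theorem integrableOn_Ioi_ofReal_mul_cexp_neg_mul {a : ℂ} (ha : 0 < a.re) :
    IntegrableOn (fun ω : ℝ => (ω : ℂ) * Complex.exp (-(a * ω))) (Set.Ioi 0) := by
  refine (integrableOn_Ioi_mul_exp_neg_mul ha).mono'
    (Continuous.aestronglyMeasurable (by fun_prop)) ?_
  filter_upwards [ae_restrict_mem measurableSet_Ioi] with ω hω
  exact (norm_ofReal_mul_cexp_neg_mul a hω).le

theorem integral_Ioi_mul_exp_neg_mul {r : ℝ} (hr : 0 < r) :
    ∫ ω in Set.Ioi (0 : ℝ), ω * Real.exp (-(r * ω)) = (r ^ 2)⁻¹ := by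
  have h := Real.integral_rpow_mul_exp_neg_mul_Ioi (a := 2) two_pos hr
  norm_num at h
  exact h

theorem tendsto_affine_mul_cexp_neg_mul {a : ℂ} (ha : 0 < a.re) (c d : ℂ) :
    Filter.Tendsto (fun ω : ℝ => (c * ω + d) * Complex.exp (-(a * ω))) Filter.atTop (nhds 0) := by
  have key (s : ℝ) := tendsto_rpow_mul_exp_neg_mul_atTop_nhds_zero s a.re ha
  have hb : Filter.Tendsto (fun ω : ℝ => ‖c‖ * (ω ^ (1 : ℝ) * Real.exp (-a.re * ω)) +
      ‖d‖ * (ω ^ (0 : ℝ) * Real.exp (-a.re * ω))) Filter.atTop (nhds 0) := by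
    simpa only [mul_zero, add_zero] using
      ((key 1).const_mul ‖c‖).add ((key 0).const_mul ‖d‖)
  refine squeeze_zero_norm' ?_ hb
  filter_upwards [Filter.eventually_gt_atTop 0] with ω hω
  have he : ‖Complex.exp (-(a * ω))‖ = Real.exp (-a.re * ω) := by
    simp [Complex.norm_exp]
  have hn : ‖c * ω + d‖ ≤ ‖c‖ * ω + ‖d‖ := by
    refine (norm_add_le _ _).trans_eq ?_
    rw [norm_mul, Complex.norm_real, Real.norm_of_nonneg hω.le]
  rw [norm_mul, he, rpow_one, rpow_zero]
  calc _ ≤ (‖c‖ * ω + ‖d‖) * Real.exp (-a.re * ω) := by gcongr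
    _ = _ := by ring

theorem integral_Ioi_ofReal_mul_cexp_neg_mul {a : ℂ} (ha : 0 < a.re) :
    ∫ ω in Set.Ioi (0 : ℝ), (ω : ℂ) * Complex.exp (-(a * ω)) = (a ^ 2)⁻¹ := by
  have ha0 : a ≠ 0 := by rintro rfl; simp at ha
  have hd (ω : ℝ) : HasDerivAt (fun ω : ℝ => (-a⁻¹ * ω + -(a ^ 2)⁻¹) * Complex.exp (-(a * ω)))
      ((ω : ℂ) * Complex.exp (-(a * ω))) ω := by
    have h1 : HasDerivAt (fun ω : ℝ => -a⁻¹ * (ω : ℂ) + -(a ^ 2)⁻¹) (-a⁻¹ * 1) ω :=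
      ((hasDerivAt_id ω).ofReal_comp.const_mul (-a⁻¹)).add_const _
    have h2 : HasDerivAt (fun ω : ℝ => Complex.exp (-(a * ω)))
        (Complex.exp (-(a * ω)) * -(a * 1)) ω :=
      ((hasDerivAt_id ω).ofReal_comp.const_mul a).neg.cexp
    refine (h1.mul h2).congr_deriv ?_
    field_simp
    ring
  rw [integral_Ioi_of_hasDerivAt_of_tendsto' (fun ω _ => hd ω)
    (integrableOn_Ioi_ofReal_mul_cexp_neg_mul ha) (tendsto_affine_mul_cexp_neg_mul ha _ _)]
  simp

theorem hasSum_bose_expansion (a : ℂ) {β ω : ℝ} (h : 0 < β * ω) :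
    HasSum (fun n : ℕ => (ω : ℂ) * Complex.exp (-((a + n * β) * ω)))
      ((ω : ℂ) * Complex.exp (-(a * ω)) * (1 - (Real.exp (-β * ω) : ℂ))⁻¹) := by
  have hlt : ‖(Real.exp (-β * ω) : ℂ)‖ < 1 := by
    rw [Complex.norm_real, Real.norm_of_nonneg (Real.exp_pos _).le, Real.exp_lt_one_iff]
    linarith
  refine ((hasSum_geometric_of_norm_lt_one hlt).mul_left
    ((ω : ℂ) * Complex.exp (-(a * ω)))).congr_fun fun n => ?_
  rw [Complex.ofReal_exp, ← Complex.exp_nat_mul, mul_assoc, ← Complex.exp_add]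
  push_cast
  ring_nf

theorem mul_inv_one_sub_exp_neg_le {x : ℝ} (hx : 0 < x) :
    x * (1 - Real.exp (-x))⁻¹ ≤ x + 1 := by
  have h1 : 0 < 1 - Real.exp (-x) := by
    rw [sub_pos, Real.exp_lt_one_iff]; linarith
  rw [← div_eq_mul_inv, div_le_iff₀ h1]
  have h2 : (x + 1) * Real.exp (-x) ≤ 1 := by
    rw [Real.exp_neg, ← div_eq_mul_inv, div_le_one (Real.exp_pos _)]
    exact Real.add_one_le_exp x
  linarith

theorem integrableOn_bose {a : ℂ} {β : ℝ} (ha : 0 < a.re) (hβ : 0 < β) :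
    IntegrableOn (fun ω : ℝ => (ω : ℂ) * Complex.exp (-(a * ω)) *
      (1 - (Real.exp (-β * ω) : ℂ))⁻¹) (Set.Ioi 0) := by
  have hint : IntegrableOn (fun ω : ℝ => ω * Real.exp (-(a.re * ω)) +
      β⁻¹ * Real.exp (-a.re * ω)) (Set.Ioi 0) :=
    (integrableOn_Ioi_mul_exp_neg_mul ha).add ((exp_neg_integrableOn_Ioi 0 ha).const_mul _)
  refine hint.mono' (Measurable.aestronglyMeasurable (by fun_prop)) ?_
  filter_upwards [ae_restrict_mem measurableSet_Ioi] with ω hω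
  have hω : 0 < ω := hω
  have hx : 0 < β * ω := mul_pos hβ hω
  have hpos : 0 ≤ 1 - Real.exp (-β * ω) := by
    rw [sub_nonneg, Real.exp_le_one_iff]; linarith
  have hden : ‖(1 - (Real.exp (-β * ω) : ℂ))⁻¹‖ = (1 - Real.exp (-(β * ω)))⁻¹ := by
    rw [norm_inv, ← Complex.ofReal_one, ← Complex.ofReal_sub, Complex.norm_real,
      Real.norm_of_nonneg hpos, neg_mul]
  rw [norm_mul, norm_ofReal_mul_cexp_neg_mul a hω, hden, neg_mul]
  have := mul_inv_one_sub_exp_neg_le hx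
  calc _ = β⁻¹ * (β * ω * (1 - Real.exp (-(β * ω)))⁻¹) * Real.exp (-(a.re * ω)) := by
        field_simp
    _ ≤ β⁻¹ * (β * ω + 1) * Real.exp (-(a.re * ω)) := by gcongr
    _ = _ := by field_simp

theorem summable_inv_add_nat_mul_sq {r β : ℝ} (hr : 0 < r) (hβ : 0 < β) :
    Summable (fun n : ℕ => ((r + n * β) ^ 2)⁻¹) := by
  refine .of_norm_bounded_eventually_nat
    ((Real.summable_nat_pow_inv.2 one_lt_two).mul_left (β ^ 2)⁻¹) ?_
  filter_upwards [Filter.eventually_gt_atTop 0] with n hn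
  have hn' : (0 : ℝ) < n := by exact_mod_cast hn
  rw [Real.norm_of_nonneg (by positivity), ← mul_inv, ← mul_pow]
  gcongr
  linarith

theorem hasSum_integral_bose {a : ℂ} {β : ℝ} (ha : 0 < a.re) (hβ : 0 < β) :
    HasSum (fun n : ℕ => ((a + n * β) ^ 2)⁻¹)
      (∫ ω in Set.Ioi (0 : ℝ), (ω : ℂ) * Complex.exp (-(a * ω)) *
        (1 - (Real.exp (-β * ω) : ℂ))⁻¹) := by
  have hre (n : ℕ) : (a + n * β).re = a.re + n * β := by simp
  have hpos (n : ℕ) : 0 < (a + n * β).re := by rw [hre]; positivity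
  have hnorm (n : ℕ) : ∫ ω in Set.Ioi (0 : ℝ), ‖(ω : ℂ) * Complex.exp (-((a + n * β) * ω))‖ =
      ((a.re + n * β) ^ 2)⁻¹ := by
    rw [← hre, ← integral_Ioi_mul_exp_neg_mul (hpos n)]
    exact setIntegral_congr_fun measurableSet_Ioi fun ω hω => norm_ofReal_mul_cexp_neg_mul _ hω
  have h := hasSum_integral_of_summable_integral_norm
    (fun n : ℕ => integrableOn_Ioi_ofReal_mul_cexp_neg_mul (hpos n))
    (by simpa only [hnorm] using summable_inv_add_nat_mul_sq ha hβ)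
  simp only [fun n : ℕ => integral_Ioi_ofReal_mul_cexp_neg_mul (hpos n)] at h
  rwa [setIntegral_congr_fun measurableSet_Ioi fun ω hω =>
    (hasSum_bose_expansion a (mul_pos hβ hω)).tsum_eq] at h

/-- Image-sum representation of the massless thermal two-point function on the
    time axis: for 0 < Im z < β,
    (1/(4π²)) ∫₀^∞ ω (e^{iωz} + e^{−iωz}e^{−βω})(1 − e^{−βω})⁻¹ dω
      = −(1/(4π²)) Σ_{n∈ℤ} (z + inβ)⁻². -/
theorem massless_thermal_image_sum (β : ℝ) (hβ : 0 < β) (z : ℂ)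
    (h1 : 0 < z.im) (h2 : z.im < β) :
    IntegrableOn (fun ω : ℝ => (ω : ℂ) *
        (Complex.exp (Complex.I * (ω : ℂ) * z) +
          Complex.exp (-(Complex.I * (ω : ℂ) * z)) * (Real.exp (-β * ω) : ℂ)) *
        (1 - (Real.exp (-β * ω) : ℂ))⁻¹) (Set.Ioi 0) ∧
    Summable (fun n : ℤ => ((z + (n : ℂ) * Complex.I * (β : ℂ)) ^ 2)⁻¹) ∧
    (1 / (4 * (Real.pi : ℂ) ^ 2)) *
        ∫ ω in Set.Ioi (0 : ℝ), (ω : ℂ) *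
          (Complex.exp (Complex.I * (ω : ℂ) * z) +
            Complex.exp (-(Complex.I * (ω : ℂ) * z)) * (Real.exp (-β * ω) : ℂ)) *
          (1 - (Real.exp (-β * ω) : ℂ))⁻¹ =
      -(1 / (4 * (Real.pi : ℂ) ^ 2)) *
        ∑' n : ℤ, ((z + (n : ℂ) * Complex.I * (β : ℂ)) ^ 2)⁻¹ := by
  have ha : 0 < (-(I * z)).re := by simpa using h1
  have hb : 0 < (I * z + β).re := by simpa using h2
  have hsplit (ω : ℝ) : (ω : ℂ) * (Complex.exp (I * ω * z) +
      Complex.exp (-(I * ω * z)) * (Real.exp (-β * ω) : ℂ)) * (1 - (Real.exp (-β * ω) : ℂ))⁻¹ =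
      (ω : ℂ) * Complex.exp (-(-(I * z) * ω)) * (1 - (Real.exp (-β * ω) : ℂ))⁻¹ +
      (ω : ℂ) * Complex.exp (-((I * z + β) * ω)) * (1 - (Real.exp (-β * ω) : ℂ))⁻¹ := by
    have e1 : I * ω * z = -(-(I * z) * ω) := by ring
    have e2 : Complex.exp (-(I * ω * z)) * (Real.exp (-β * ω) : ℂ) =
        Complex.exp (-((I * z + β) * ω)) := by
      rw [Complex.ofReal_exp, ← Complex.exp_add]
      push_cast
      ring_nf
    rw [e2, e1]
    ring
  simp only [hsplit]
  have hsum := HasSum.of_nat_of_neg_add_one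
    (f := fun n : ℤ => -((z + (n : ℂ) * I * (β : ℂ)) ^ 2)⁻¹)
    ((hasSum_integral_bose ha hβ).congr_fun fun n => by
      rw [← inv_neg]
      congr 1
      push_cast
      linear_combination -(z ^ 2 + n ^ 2 * (β : ℂ) ^ 2) * I_sq)
    ((hasSum_integral_bose hb hβ).congr_fun fun n => by
      rw [← inv_neg]
      congr 1
      push_cast
      linear_combination -(z ^ 2 + (n + 1) ^ 2 * (β : ℂ) ^ 2) * I_sq)
  rw [← integral_add (integrableOn_bose ha hβ) (integrableOn_bose hb hβ)] at hsum
  refine ⟨(integrableOn_bose ha hβ).add (integrableOn_bose hb hβ), ?_, ?_⟩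
  · simpa using hsum.summable.neg
  · rw [← hsum.tsum_eq, tsum_neg]
    ring
end

section
/- Let m ≥ 0, β > 0 and ω_p = √(‖p‖² + m²). Then the thermal part of the two-point function clusters in time: (2π)⁻³ ∫_{ℝ³} ω_p⁻¹ (e^{βω_p} − 1)⁻¹ cos(ω_p t) dp → 0 as |t| → ∞. (This is the cluster property (iv) of the local KMS condition, w_q(t e) → 0 as |t| → ∞, for the thermal contribution of the β-KMS state evaluated along the time direction of its rest frame.) -/
open MeasureTheory Real Filter

open scoped FourierTransform

/-- The Riemann-Lebesgue lemma for the cosine transform of a real integrable function. -/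
theorem tendsto_integral_mul_cos_cocompact {f : ℝ → ℝ} (hf : Integrable f) :
    Tendsto (fun t : ℝ => ∫ x, f x * cos (x * t)) (cocompact ℝ) (nhds 0) := by
  have hscale : Tendsto (fun t : ℝ => t * (2 * π)⁻¹) (cocompact ℝ) (cocompact ℝ) :=
    (Homeomorph.mulRight₀ _ (inv_ne_zero two_pi_pos.ne')).isClosedEmbedding.tendsto_cocompact
  have hre := (Complex.continuous_re.tendsto 0).comp
    ((Real.tendsto_integral_exp_smul_cocompact fun x => (f x : ℂ)).comp hscale)
  rw [Complex.zero_re] at hre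
  refine hre.congr fun t => ?_
  have hfourier : Integrable fun x : ℝ => 𝐞 (-(x * (t * (2 * π)⁻¹))) • (f x : ℂ) := by
    have := (Real.fourierIntegral_convergent_iff (μ := volume) (f := fun x => (f x : ℂ))
      (t * (2 * π)⁻¹)).2 hf.ofReal
    simpa [mul_comm] using this
  refine (integral_re hfourier).symm.trans (integral_congr_ae (.of_forall fun x => ?_))
  have harg : 2 * π * -(x * (t * (2 * π)⁻¹)) = -(x * t) := by
    field_simp
  simp only [Circle.smul_def, Real.fourierChar_apply, harg, smul_eq_mul, RCLike.re_to_complex,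
    Complex.re_mul_ofReal, Complex.exp_ofReal_mul_I_re, cos_neg]
  ring

/-- The Bose-Einstein weight is dominated by a decaying exponential. -/
theorem mul_inv_exp_sub_one_le {β x : ℝ} (hβ : 0 < β) (hx : 0 < x) :
    x * (exp (β * x) - 1)⁻¹ ≤ β⁻¹ * exp (-(β / 2) * x) := by
  have hβx : 0 < β * x := mul_pos hβ hx
  have hsinh : β * x / 2 ≤ sinh (β * x / 2) := self_le_sinh_iff.2 (by positivity)
  rw [sinh_eq] at hsinh
  have hexp : exp (β * x) = exp (β * x / 2) * exp (β * x / 2) := by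
    rw [← exp_add, add_halves]
  have hone : exp (β * x / 2) * exp (-(β * x / 2)) = 1 := by
    rw [← exp_add, add_neg_cancel, exp_zero]
  have hbound : β * x * exp (β * x / 2) ≤ exp (β * x) - 1 := by
    nlinarith [exp_pos (β * x / 2)]
  have hneg : exp (-(β / 2) * x) = (exp (β * x / 2))⁻¹ := by
    rw [← exp_neg]; ring_nf
  calc x * (exp (β * x) - 1)⁻¹ ≤ x * (β * x * exp (β * x / 2))⁻¹ := by gcongr
    _ = β⁻¹ * exp (-(β / 2) * x) := by
      rw [hneg]; field_simp

theorem integrableOn_sqrt_mul_inv_exp_sub_one {m β : ℝ} (hm : 0 ≤ m) (hβ : 0 < β) :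
    IntegrableOn (fun x : ℝ => √(x ^ 2 - m ^ 2) * (exp (β * x) - 1)⁻¹) (Set.Ioi m) := by
  refine Integrable.mono' ((integrableOn_exp_mul_Ioi (a := -(β / 2)) (by linarith) m).const_mul β⁻¹)
    (by fun_prop) ?_
  filter_upwards [ae_restrict_mem measurableSet_Ioi] with x hx
  have hx0 : 0 < x := hm.trans_lt hx
  have hexp : 0 < exp (β * x) - 1 := sub_pos.2 (one_lt_exp_iff.2 (mul_pos hβ hx0))
  rw [norm_of_nonneg (by positivity)]
  refine le_trans ?_ (mul_inv_exp_sub_one_le hβ hx0)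
  gcongr
  exact sqrt_le_iff.2 ⟨hx0.le, by nlinarith⟩

theorem image_sqrt_sq_add_sq_Ioi {m : ℝ} (hm : 0 ≤ m) :
    (fun r : ℝ => √(r ^ 2 + m ^ 2)) '' Set.Ioi 0 = Set.Ioi m := by
  ext x
  constructor
  · rintro ⟨r, hr : 0 < r, rfl⟩
    exact lt_sqrt_of_sq_lt (by nlinarith)
  · intro (hx : m < x)
    refine ⟨√(x ^ 2 - m ^ 2), sqrt_pos.2 (by nlinarith), ?_⟩
    simp only
    rw [sq_sqrt (by nlinarith), sub_add_cancel, sqrt_sq (hm.trans hx.le)]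

/-- Integration over momenta of a function of the energy, with the energy as variable. -/
theorem integral_comp_omega {m : ℝ} (hm : 0 ≤ m) (g : ℝ → ℝ) :
    ∫ p : EuclideanSpace ℝ (Fin 3), g (omega m p) =
      3 * volume.real (Metric.ball (0 : EuclideanSpace ℝ (Fin 3)) 1) *
        ∫ x in Set.Ioi m, x * √(x ^ 2 - m ^ 2) * g x := by
  have hpolar := integral_fun_norm_addHaar (volume : Measure (EuclideanSpace ℝ (Fin 3)))
    fun r => g √(r ^ 2 + m ^ 2)
  have hderiv : ∀ r ∈ Set.Ioi (0 : ℝ), HasDerivWithinAt (fun r : ℝ => √(r ^ 2 + m ^ 2))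
      (r / √(r ^ 2 + m ^ 2)) (Set.Ioi 0) r := by
    intro r (hr : 0 < r)
    have := (((hasDerivAt_id r).pow 2).add_const (m ^ 2)).sqrt (by simp; positivity)
    refine (this.congr_deriv ?_).hasDerivWithinAt
    simp
    field_simp
  have hinj : Set.InjOn (fun r : ℝ => √(r ^ 2 + m ^ 2)) (Set.Ioi 0) := by
    intro a (ha : 0 < a) b (hb : 0 < b) hab
    have h := (sqrt_inj (by positivity) (by positivity)).1 hab
    exact (pow_left_inj₀ ha.le hb.le two_ne_zero).1 (by linarith)
  have hsubst := integral_image_eq_integral_abs_deriv_smul measurableSet_Ioi hderiv hinj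
    fun x => x * √(x ^ 2 - m ^ 2) * g x
  rw [image_sqrt_sq_add_sq_Ioi hm] at hsubst
  rw [hsubst]
  simp only [omega]
  rw [hpolar, finrank_euclideanSpace_fin, nsmul_eq_mul, smul_eq_mul, Nat.cast_ofNat, mul_assoc]
  congr 2
  refine setIntegral_congr_fun measurableSet_Ioi fun r (hr : 0 < r) => ?_
  have hω : 0 < √(r ^ 2 + m ^ 2) := by positivity
  simp only [smul_eq_mul]
  rw [abs_of_pos (div_pos hr hω), sq_sqrt (by positivity), add_sub_cancel_right, sqrt_sq hr.le]
  field_simp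

/-- Cluster property in time of the thermal part of the two-point function:
    (2π)⁻³ ∫_{ℝ³} ω_p⁻¹ (e^{βω_p} − 1)⁻¹ cos(ω_p t) dp → 0 as |t| → ∞. -/
theorem thermal_cluster_property (m β : ℝ) (hm : 0 ≤ m) (hβ : 0 < β) :
    Tendsto (fun t : ℝ =>
        ((2 * Real.pi) ^ 3)⁻¹ *
          ∫ p : EuclideanSpace ℝ (Fin 3),
            (omega m p)⁻¹ * (Real.exp (β * omega m p) - 1)⁻¹ *
              Real.cos (omega m p * t))
      (cocompact ℝ) (nhds 0) := by
  have hlim := (tendsto_integral_mul_cos_cocompact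
    ((integrableOn_sqrt_mul_inv_exp_sub_one hm hβ).integrable_indicator
      measurableSet_Ioi)).const_mul
    (((2 * π) ^ 3)⁻¹ * (3 * volume.real (Metric.ball (0 : EuclideanSpace ℝ (Fin 3)) 1)))
  rw [mul_zero] at hlim
  refine hlim.congr fun t => ?_
  rw [integral_comp_omega hm fun x => x⁻¹ * (exp (β * x) - 1)⁻¹ * cos (x * t), mul_assoc,
    ← integral_indicator measurableSet_Ioi]
  congr 2
  refine integral_congr_ae (.of_forall fun x => ?_)
  by_cases hx : x ∈ Set.Ioi m
  · have hx0 : x ≠ 0 := (hm.trans_lt hx).ne'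
    simp only [Set.indicator_of_mem hx]
    field_simp
  · simp [Set.indicator_of_notMem hx]
end
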